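/- arXiv:2508.18176 — 2 statements merged into one kernel-verified Lean document; each statement's English description precedes it below -/
import Mathlib

section
/- Let (Δ,δ) be a building of type (W,S) where W satisfies the nested condition relative to u ∈ S. Let C, D, E ∈ Δ and let φ, φ₁, φ₂ : W → Δ be isometries with φ(1) = D = φ₁(1), φ(w) = C, φ₁(w₁) = E, φ₂(1) = C, and φ₂(w₂) = E, for elements w, w₁, w₂ ∈ W. If w·H_u^+ = H_u^- and H_u^- ⊊ w₁·H_u^† for some sign † ∈ {+, −}, then H_u^+ ⊊ w₂·H_u^†. -/
open Pointwise
open scoped Classical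

variable {B : Type*} {W : Type*} [Group W] {M : CoxeterMatrix B}

/-- The positive root `H_s^+` associated to the generator indexed by `i`:
elements `g` with `l(sg) > l(g)`. -/
def Hp (cs : CoxeterSystem M W) (i : B) : Set W :=
  {g : W | cs.length g < cs.length (cs.simple i * g)}

/-- The negative root `H_s^-`: elements `g` with `l(sg) < l(g)`. -/
def Hm (cs : CoxeterSystem M W) (i : B) : Set W :=
  {g : W | cs.length (cs.simple i * g) < cs.length g}

/-- `g` satisfies one of the six cases of the nested condition relative to `s`. -/
def NestedAt (cs : CoxeterSystem M W) (i : B) (g : W) : Prop :=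
  g • Hp cs i = Hp cs i ∨ g • Hp cs i = Hm cs i ∨
  g • Hp cs i ⊂ Hp cs i ∨ g • Hp cs i ⊂ Hm cs i ∨
  g • Hm cs i ⊂ Hp cs i ∨ g • Hm cs i ⊂ Hm cs i

/-- `W` satisfies the nested condition relative to the generator indexed by `i`. -/
def Nested (cs : CoxeterSystem M W) (i : B) : Prop := ∀ g : W, NestedAt cs i g

/-- The stabilizer `Stab_{H_s^+}` of the positive root. -/
def StabHp (cs : CoxeterSystem M W) (i : B) : Set W :=
  {g : W | g • Hp cs i = Hp cs i}

/-- The multiplier `m_W^s`. -/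
noncomputable def mWs (cs : CoxeterSystem M W) (i : B) (g : W) : ℤ :=
  if g ∈ Hp cs i then 1 else -1

/-- `(Δ, d)` is a building of type `(W,S)`: axioms (B1), (B2), (B3). -/
def IsBuilding (cs : CoxeterSystem M W) (Δ : Type*) (d : Δ → Δ → W) : Prop :=
  Nonempty Δ ∧
  (∀ C D : Δ, d C D = 1 ↔ C = D) ∧
  (∀ (C D E : Δ) (i : B), d E C = cs.simple i →
    (d E D = cs.simple i * d C D ∨ d E D = d C D) ∧
    (cs.length (d C D) < cs.length (cs.simple i * d C D) → d E D = cs.simple i * d C D)) ∧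
  (∀ (C D : Δ) (i : B), ∃ E : Δ, d E C = cs.simple i ∧ d E D = cs.simple i * d C D)

/-- `φ : W → Δ` is an isometry into the building. -/
def IsIsom {Δ : Type*} (d : Δ → Δ → W) (φ : W → Δ) : Prop :=
  ∀ a b : W, d (φ a) (φ b) = a⁻¹ * b

namespace CoxeterSystem

variable (cs : CoxeterSystem M W)

/-- The action of a simple reflection on signed group elements: conjugation by the reflection,
with a change of sign exactly on the reflection itself. -/
noncomputable def signedConj (i : B) : Function.End (W × ZMod 2) :=
  fun p ↦ (cs.simple i * p.1 * cs.simple i, p.2 + if p.1 = cs.simple i then 1 else 0)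

theorem prod_signedConj_apply (ω : List B) (t : W) (ε : ZMod 2) :
    (ω.map cs.signedConj).prod (t, ε) =
      (cs.wordProd ω * t * (cs.wordProd ω)⁻¹, ε + ((cs.rightInvSeq ω).count t : ZMod 2)) := by
  induction ω with
  | nil => simp [Function.End.one_def]
  | cons i ω ih =>
    have key : (cs.wordProd ω * t * (cs.wordProd ω)⁻¹ = cs.simple i) ↔
        ((cs.wordProd ω)⁻¹ * cs.simple i * cs.wordProd ω = t) := by
      constructor <;> intro h
      · rw [← h]; group
      · rw [← h]; group
    rw [List.map_cons, List.prod_cons]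
    change cs.signedConj i ((ω.map cs.signedConj).prod (t, ε)) = _
    rw [ih]
    simp only [signedConj, key, rightInvSeq, List.count_cons, beq_iff_eq]
    simp only [wordProd_cons, mul_inv_rev, inv_simple, mul_assoc, Prod.mk.injEq, true_and]
    push_cast
    rw [add_assoc]

theorem prod_map_reverse_alternatingWord {G : Type*} [Monoid G] (f : B → G) (i j : B) (p : ℕ) :
    ((alternatingWord j i (2 * p)).reverse.map f).prod = (f i * f j) ^ p := by
  induction p with
  | zero => simp [alternatingWord]
  | succ p ih =>
    rw [show 2 * (p + 1) = 2 * p + 1 + 1 by ring, alternatingWord_succ, alternatingWord_succ,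
      pow_succ', ← ih]
    simp [mul_assoc]

theorem leftInvSeq_alternatingWord_take_eq_drop (i j : B) :
    (cs.leftInvSeq (alternatingWord i j (2 * M i j))).take (M i j) =
      (cs.leftInvSeq (alternatingWord i j (2 * M i j))).drop (M i j) := by
  apply List.ext_getElem
  · simp; omega
  · intro k h₁ h₂
    have hk : k < M i j := by simp at h₁; omega
    rw [List.getElem_take, List.getElem_drop,
      cs.getElem_leftInvSeq_alternatingWord i j _ _ (by omega),
      cs.getElem_leftInvSeq_alternatingWord i j _ _ (by omega),
      prod_alternatingWord_eq_mul_pow, prod_alternatingWord_eq_mul_pow]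
    rw [show (2 * k + 1) / 2 = k by omega, show (2 * (M i j + k) + 1) / 2 = M i j + k by omega,
      pow_add]
    simp

theorem isLiftable_signedConj : M.IsLiftable cs.signedConj := by
  intro i j
  funext ⟨t, ε⟩
  have h : cs.wordProd (alternatingWord j i (2 * M i j)).reverse = 1 := by
    rw [wordProd, prod_map_reverse_alternatingWord, simple_mul_simple_pow]
  rw [← prod_map_reverse_alternatingWord, prod_signedConj_apply, h, rightInvSeq_reverse,
    List.count_reverse, M.symmetric i j,
    ← List.take_append_drop (M j i) (cs.leftInvSeq _), List.count_append,
    ← leftInvSeq_alternatingWord_take_eq_drop]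
  simp [Function.End.one_def, CharTwo.add_self_eq_zero]

/-- The parity of the number of times `t` occurs in the right inversion sequence of a word
depends only on the product of the word. -/
theorem count_rightInvSeq_congr {ω ω' : List B} (h : cs.wordProd ω = cs.wordProd ω') (t : W) :
    ((cs.rightInvSeq ω).count t : ZMod 2) = (cs.rightInvSeq ω').count t := by
  have lift_eq (ω : List B) :
      cs.lift ⟨_, cs.isLiftable_signedConj⟩ (cs.wordProd ω) = (ω.map cs.signedConj).prod := by
    rw [wordProd, map_list_prod, List.map_map]
    congr 2
    funext i
    exact cs.lift_apply_simple cs.isLiftable_signedConj i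
  have h' := congrArg Prod.snd (congrFun ((lift_eq ω).symm.trans (h ▸ lift_eq ω')) (t, 0))
  simpa [prod_signedConj_apply] using h'

/-- The exchange condition on the right. -/
theorem mem_rightInvSeq_of_isRightDescent {ω : List B} {i : B}
    (h : cs.IsRightDescent (cs.wordProd ω) i) : cs.simple i ∈ cs.rightInvSeq ω := by
  obtain ⟨ω', hω', hprod⟩ := cs.exists_isReduced (cs.wordProd ω * cs.simple i)
  have hnot : cs.simple i ∉ cs.rightInvSeq ω' := fun hmem ↦ by
    have := (cs.isRightInversion_of_mem_rightInvSeq hω' hmem).2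
    rw [← hprod, simple_mul_simple_cancel_right] at this
    exact lt_asymm h this
  have hcongr := cs.count_rightInvSeq_congr (ω := ω) (ω' := ω'.concat i)
    (by rw [wordProd_concat, ← hprod, simple_mul_simple_cancel_right]) (cs.simple i)
  by_contra hmem
  have hzero : (List.map (MulAut.conj (cs.simple i)) (cs.rightInvSeq ω')).count (cs.simple i)
      = 0 := by
    rw [List.count_eq_zero]
    intro hm
    obtain ⟨t, ht, hti⟩ := List.mem_map.1 hm
    have : t = cs.simple i := (MulAut.conj (cs.simple i)).injective (by rw [hti]; simp)
    exact hnot (this ▸ ht)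
  rw [List.count_eq_zero.2 hmem, rightInvSeq_concat, List.concat_eq_append, List.count_append,
    hzero] at hcongr
  simp at hcongr

/-- The exchange condition on the left. -/
theorem mem_leftInvSeq_of_isLeftDescent {ω : List B} {i : B}
    (h : cs.IsLeftDescent (cs.wordProd ω) i) : cs.simple i ∈ cs.leftInvSeq ω := by
  rw [← List.mem_reverse, ← rightInvSeq_reverse]
  apply mem_rightInvSeq_of_isRightDescent
  rwa [wordProd_reverse, isRightDescent_inv_iff]

/-- If right multiplication by `s_j` creates the left descent `i`, then `s_i w = w s_j`. -/
theorem simple_mul_eq_mul_simple {w : W} {i j : B} (h : ¬cs.IsLeftDescent w i)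
    (h' : cs.IsLeftDescent (w * cs.simple j) i) : cs.simple i * w = w * cs.simple j := by
  obtain ⟨ω, hω, rfl⟩ := cs.exists_isReduced w
  rw [← wordProd_concat] at h'
  have hmem := cs.mem_leftInvSeq_of_isLeftDescent h'
  rw [leftInvSeq_concat, List.concat_eq_append, List.mem_append, List.mem_singleton] at hmem
  rcases hmem with hmem | heq
  · exact absurd (cs.isLeftInversion_of_mem_leftInvSeq hω hmem).2 h
  · rw [heq]; group

/-- An element with two distinct left descents `i` and `j` keeps the descent `i` after
removal of `j`. -/
theorem isLeftDescent_simple_mul {w : W} {i j : B} (hij : cs.simple j ≠ cs.simple i)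
    (hi : cs.IsLeftDescent w i) (hj : cs.IsLeftDescent w j) :
    cs.IsLeftDescent (cs.simple j * w) i := by
  obtain ⟨ω, hω, hz⟩ := cs.exists_isReduced (cs.simple i * w)
  have hw : w = cs.wordProd (i :: ω) := by
    rw [wordProd_cons, ← hz, simple_mul_simple_cancel_left]
  have hmem := cs.mem_leftInvSeq_of_isLeftDescent (hw ▸ hj)
  rw [leftInvSeq, List.mem_cons, List.mem_map] at hmem
  obtain heq | ⟨t, ht, htj⟩ := hmem
  · exact absurd heq hij
  have hlt := (cs.isLeftInversion_of_mem_leftInvSeq hω ht).2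
  have ht' : t * (cs.simple i * w) = cs.simple i * (cs.simple j * w) := by
    rw [← htj, MulAut.conj_apply, inv_simple]
    simp only [mul_assoc, simple_mul_simple_cancel_left]
  rw [← hz, ht'] at hlt
  rw [isLeftDescent_iff] at hi hj
  rw [IsLeftDescent]
  omega

end CoxeterSystem

section Roots

variable {cs : CoxeterSystem M W} {u : B}

theorem mem_Hm_iff_not_mem_Hp {g : W} : g ∈ Hm cs u ↔ g ∉ Hp cs u := by
  have := cs.length_simple_mul_ne g u
  simp only [Hm, Hp, Set.mem_ofPred_eq]
  omega

theorem compl_Hp : (Hp cs u)ᶜ = Hm cs u := by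
  ext g
  exact mem_Hm_iff_not_mem_Hp.symm

theorem compl_Hm : (Hm cs u)ᶜ = Hp cs u := by
  rw [← compl_Hp, compl_compl]

theorem one_mem_Hp : (1 : W) ∈ Hp cs u := by
  simp [Hp]

theorem simple_mem_Hm : cs.simple u ∈ Hm cs u := by
  simp [Hm]

theorem simple_smul_Hp : cs.simple u • Hp cs u = Hm cs u := by
  ext g
  simp [Set.mem_smul_set_iff_inv_smul_mem, Hm, Hp]

theorem simple_smul_Hm : cs.simple u • Hm cs u = Hp cs u := by
  rw [← simple_smul_Hp, smul_smul, cs.simple_mul_simple_self, one_smul]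

theorem smul_Hm_eq_of_smul_Hp_eq {g : W} (h : g • Hp cs u = Hp cs u) :
    g • Hm cs u = Hm cs u := by
  rw [← compl_Hp, Set.smul_set_compl, h]

theorem smul_Hp_eq_of_smul_Hm_eq {g : W} (h : g • Hm cs u = Hm cs u) :
    g • Hp cs u = Hp cs u := by
  rw [← compl_Hm, Set.smul_set_compl, h]

theorem simple_mul_eq_mul_simple_of_mem {g : W} (h : g ∈ Hp cs u)
    (h' : g * cs.simple u ∈ Hm cs u) : cs.simple u * g = g * cs.simple u :=
  cs.simple_mul_eq_mul_simple (lt_asymm h) h'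

theorem simple_smul_eq_of_subset {A : Set W} {i : B} (h : cs.simple i • A ⊆ A) :
    cs.simple i • A = A := by
  refine h.antisymm ?_
  have := Set.smul_set_mono (a := cs.simple i) h
  rwa [smul_smul, cs.simple_mul_simple_self, one_smul] at this

theorem mem_Hp_of_smul_eq {g : W} (h : g • Hp cs u = Hp cs u) : g ∈ Hp cs u := by
  rw [← h]
  exact ⟨1, one_mem_Hp, mul_one g⟩

/-- Under the nested condition, the left descents of an element stabilizing a root
stabilize that root as well. -/
theorem simple_smul_Hp_of_isLeftDescent (hnest : Nested cs u) {z : W} {i : B}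
    (hz : z • Hp cs u = Hp cs u) (hi : cs.IsLeftDescent z i) :
    cs.simple i • Hp cs u = Hp cs u := by
  have hzp : z ∈ Hp cs u := mem_Hp_of_smul_eq hz
  have hzu : z * cs.simple u ∈ Hm cs u := by
    rw [← smul_Hm_eq_of_smul_Hp_eq hz]
    exact ⟨_, simple_mem_Hm, rfl⟩
  have hcomm := simple_mul_eq_mul_simple_of_mem hzp hzu
  have hne : cs.simple i ≠ cs.simple u := fun h ↦ by
    rw [CoxeterSystem.IsLeftDescent, h] at hi
    exact lt_asymm hi hzp
  have hip : cs.simple i ∈ Hp cs u := by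
    by_contra h
    have := mem_Hm_iff_not_mem_Hp.2 h
    simp only [Hm, Set.mem_ofPred_eq, cs.length_simple, Nat.lt_one_iff,
      cs.length_eq_zero_iff] at this
    exact hne (by rw [← cs.inv_simple u]; exact eq_inv_of_mul_eq_one_right this)
  have hyi : cs.IsLeftDescent (z * cs.simple u) i := by
    rw [CoxeterSystem.isLeftDescent_iff] at hi
    have h₁ := cs.length_mul_simple (cs.simple i * z) u
    have h₂ : cs.length z < cs.length (cs.simple u * z) := hzp
    rw [hcomm] at h₂
    rw [CoxeterSystem.IsLeftDescent, ← mul_assoc]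
    omega
  have hy : cs.simple i * (z * cs.simple u) ∈ Hm cs u :=
    cs.isLeftDescent_simple_mul hne hzu hyi
  have hmem : cs.simple i ∈ cs.simple i • Hp cs u := ⟨1, one_mem_Hp, mul_one _⟩
  rcases hnest (cs.simple i) with h | h | h | h | h | h
  · exact h
  · exact absurd hip (mem_Hm_iff_not_mem_Hp.1 (h ▸ hmem))
  · exact simple_smul_eq_of_subset h.subset
  · exact absurd hip (mem_Hm_iff_not_mem_Hp.1 (h.subset hmem))
  · refine absurd (h.subset ⟨_, hy, ?_⟩) (mem_Hm_iff_not_mem_Hp.1 hzu)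
    exact cs.simple_mul_simple_cancel_left i
  · exact smul_Hp_eq_of_smul_Hm_eq (simple_smul_eq_of_subset h.subset)

/-- An element translating a root of `u` to a proper superset of the negative root lies in the
positive root. -/
theorem mem_Hp_of_Hm_ssubset_smul {A : Set W} (hA : A = Hp cs u ∨ A = Hm cs u) {g : W}
    (h : Hm cs u ⊂ g • A) : g ∈ Hp cs u := by
  by_contra hg
  have hgm := mem_Hm_iff_not_mem_Hp.2 hg
  rcases hA with rfl | rfl
  · have hgu : g * cs.simple u ∈ Hp cs u := by
      by_contra hgu
      have := h.subset (mem_Hm_iff_not_mem_Hp.2 hgu)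
      rw [← smul_eq_mul, Set.smul_mem_smul_set_iff] at this
      exact mem_Hm_iff_not_mem_Hp.1 simple_mem_Hm this
    have hcomm := simple_mul_eq_mul_simple_of_mem hgu
      (by rwa [cs.simple_mul_simple_cancel_right])
    rw [cs.simple_mul_simple_cancel_right] at hcomm
    have h₁ := Set.smul_set_mono (a := cs.simple u) h.subset
    have hcomm' : cs.simple u * g = g * cs.simple u := by
      nth_rw 1 [← hcomm]
      rw [cs.simple_mul_simple_cancel_left]
    rw [simple_smul_Hm, smul_smul, hcomm', mul_smul, simple_smul_Hp, ← compl_Hm, ← compl_Hp,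
      Set.smul_set_compl, Set.compl_subset_compl] at h₁
    exact h.not_subset (compl_Hp (cs := cs) ▸ h₁)
  · have := h.subset hgm
    rw [Set.mem_smul_set_iff_inv_smul_mem, smul_eq_mul, inv_mul_cancel] at this
    exact mem_Hm_iff_not_mem_Hp.1 this one_mem_Hp

theorem smul_ssubset_smul {A A' : Set W} (g : W) (h : A ⊂ A') : g • A ⊂ g • A' :=
  ⟨Set.smul_set_mono h.subset, fun h' ↦ h.not_subset (Set.smul_set_subset_smul_set_iff.1 h')⟩

/-- In a building, a proper inclusion of the positive root is preserved when the base chamber is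
moved by an element stabilizing the positive root. -/
theorem Hp_ssubset_smul_of_stabilizer (hnest : Nested cs u) {Δ : Type*} {d : Δ → Δ → W}
    (hb : IsBuilding cs Δ d) {C X E : Δ} {A : Set W}
    (hstab : d X C • Hp cs u = Hp cs u) (h : Hp cs u ⊂ d X E • A) :
    Hp cs u ⊂ d C E • A := by
  obtain ⟨-, hb₁, hb₂, hb₃⟩ := hb
  induction hn : cs.length (d X C) using Nat.strong_induction_on generalizing X with
  | _ n ih =>
    by_cases hone : d X C = 1
    · rwa [← (hb₁ X C).1 hone]
    obtain ⟨i, hi⟩ := cs.exists_leftDescent_of_ne_one hone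
    have hs := simple_smul_Hp_of_isLeftDescent hnest hstab hi
    obtain ⟨Y, hYX, hYC⟩ := hb₃ X C i
    refine ih _ (hn ▸ show cs.length (cs.simple i * d X C) < cs.length (d X C) from hi) (X := Y)
      ?_ ?_ (by rw [hYC])
    · rw [hYC, mul_smul, hstab, hs]
    · rcases (hb₂ X E Y i hYX).1 with hYE | hYE
      · have := smul_ssubset_smul (cs.simple i) h
        rwa [hs, smul_smul, ← hYE] at this
      · rwa [hYE]

end Roots

/-- Transitivity of root inclusions in a building satisfying the nested condition, case (iii). -/
theorem root_inclusion_transitivity_flip_left (cs : CoxeterSystem M W) (u : B) (hnest : Nested cs u)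
    {Δ : Type*} (d : Δ → Δ → W) (hb : IsBuilding cs Δ d)
    (φ φ₁ φ₂ : W → Δ) (hφ : IsIsom d φ) (hφ₁ : IsIsom d φ₁) (hφ₂ : IsIsom d φ₂)
    (C D E : Δ) (w w₁ w₂ : W)
    (hD : φ 1 = D) (hD₁ : φ₁ 1 = D) (hC : φ w = C) (hE₁ : φ₁ w₁ = E)
    (hC₂ : φ₂ 1 = C) (hE₂ : φ₂ w₂ = E)
    (A : Set W) (hA : A = Hp cs u ∨ A = Hm cs u)
    (h₁ : w • Hp cs u = Hm cs u) (h₂ : Hm cs u ⊂ w₁ • A) :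
    Hp cs u ⊂ w₂ • A := by
  have hDC : d D C = w := by rw [← hD, ← hC, hφ, inv_one, one_mul]
  have hDE : d D E = w₁ := by rw [← hD₁, ← hE₁, hφ₁, inv_one, one_mul]
  have hCE : d C E = w₂ := by rw [← hC₂, ← hE₂, hφ₂, inv_one, one_mul]
  obtain ⟨X, hXD, hXC⟩ := hb.2.2.2 D C u
  have hXE : d X E = cs.simple u * w₁ := by
    rw [← hDE]
    exact (hb.2.2.1 D E X u hXD).2 (hDE ▸ mem_Hp_of_Hm_ssubset_smul hA h₂)
  rw [← hCE]
  refine Hp_ssubset_smul_of_stabilizer hnest hb (X := X) ?_ ?_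
  · rw [hXC, hDC, mul_smul, h₁, simple_smul_Hm]
  · rw [hXE, mul_smul, ← simple_smul_Hm]
    exact smul_ssubset_smul _ h₂
end

section
/- Let (W,S) be a Coxeter system and s ∈ S. Then for every u ∈ S \ {s}: (a) m_{su} = 2 (i.e. su = us and s ≠ u) if and only if u·H_s^+ = H_s^+; and (b) if u·H_s^- ⊊ H_s^+, then m_{su} = ∞ (i.e. su has infinite order). -/
open Pointwise
open scoped Classical

variable {B : Type*} {W : Type*} [Group W] {M : CoxeterMatrix B}

namespace CoxeterMatrix

/-- The simple coroot indexed by `i` in the geometric representation, sending the `j`-th simple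
root to `-2 cos (π / M i j)`. -/
noncomputable def simpleCoroot (M : CoxeterMatrix B) (i : B) : Module.Dual ℝ (B →₀ ℝ) :=
  Finsupp.linearCombination ℝ fun j ↦ -2 * Real.cos (Real.pi / M i j)

theorem simpleCoroot_single (M : CoxeterMatrix B) (i j : B) :
    M.simpleCoroot i (Finsupp.single j 1) = -2 * Real.cos (Real.pi / M i j) := by
  simp [simpleCoroot]

theorem simpleCoroot_single_self (M : CoxeterMatrix B) (i : B) :
    M.simpleCoroot i (Finsupp.single i 1) = 2 := by
  simp [simpleCoroot_single]

/-- The simple reflection indexed by `i` in the geometric representation. -/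
noncomputable def simpleReflection (M : CoxeterMatrix B) (i : B) : (B →₀ ℝ) ≃ₗ[ℝ] (B →₀ ℝ) :=
  Module.reflection (M.simpleCoroot_single_self i)

theorem simpleCoroot_mul_simpleCoroot (M : CoxeterMatrix B) (i j : B) :
    2 * Real.cos (2 * (Real.pi / M i j)) =
      M.simpleCoroot i (Finsupp.single j 1) * M.simpleCoroot j (Finsupp.single i 1) - 2 := by
  rw [simpleCoroot_single, simpleCoroot_single, M.symmetric j i, Real.cos_two_mul]
  ring

theorem sin_two_mul_pi_div_ne_zero {m : ℕ} (hm : 3 ≤ m) :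
    Real.sin (2 * (Real.pi / m)) ≠ 0 := by
  have hm' : (3 : ℝ) ≤ m := by exact_mod_cast hm
  refine (Real.sin_pos_of_pos_of_lt_pi (by positivity) ?_).ne'
  rw [← mul_div_assoc, div_lt_iff₀ (by linarith)]
  nlinarith [Real.pi_pos]

open Polynomial.Chebyshev in
theorem simpleReflection_mul_simpleReflection_pow (M : CoxeterMatrix B) (i j : B) :
    (M.simpleReflection i * M.simpleReflection j) ^ M i j = 1 := by
  rcases eq_or_ne i j with rfl | hij
  · rw [M.diagonal, pow_one]
    refine LinearEquiv.ext fun v ↦ ?_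
    rw [LinearEquiv.mul_apply, LinearEquiv.coe_one, id_eq]
    exact Module.involutive_reflection (M.simpleCoroot_single_self i) v
  have h1 : M i j ≠ 1 := M.off_diagonal i j hij
  rcases Nat.lt_or_ge (M i j) 3 with h3 | h3
  · obtain h | h : M i j = 0 ∨ M i j = 2 := by omega
    · rw [h, pow_zero]
    · have hz : M.simpleCoroot i (Finsupp.single j 1) = 0 := by simp [simpleCoroot_single, h]
      have hz' : M.simpleCoroot j (Finsupp.single i 1) = 0 := by
        simp [simpleCoroot_single, M.symmetric j i, h]
      rw [h, pow_two]
      refine LinearEquiv.ext fun v ↦ ?_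
      simp only [simpleReflection, LinearEquiv.mul_apply, Module.reflection_apply, map_sub,
        map_smul, hz, hz', simpleCoroot_single_self, LinearEquiv.coe_one, id_eq]
      module
  · refine LinearEquiv.ext fun v ↦ ?_
    rw [simpleReflection, simpleReflection, Module.reflection_mul_reflection_pow_apply _ _ _ _ _
      (M.simpleCoroot_mul_simpleCoroot i j)]
    have hsin := sin_two_mul_pi_div_ne_zero h3
    have hS := S_two_mul_real_cos (2 * (Real.pi / M i j))
    have hM : (M i j : ℝ) * (Real.pi / M i j) = Real.pi := by
      field_simp
    generalize Real.pi / M i j = θ at *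
    generalize M i j = m at *
    obtain ⟨k, rfl | rfl⟩ := Nat.even_or_odd' m
    · have e1 : (((2 * k : ℕ) : ℤ) - 2) / 2 = (k : ℤ) - 1 := by omega
      have e2 : (((2 * k : ℕ) : ℤ) - 1) / 2 = (k : ℤ) - 1 := by omega
      have h0 : (S ℝ ((k : ℤ) - 1)).eval (2 * Real.cos (2 * θ)) = 0 := by
        apply (mul_eq_zero.1 ((hS _).trans ?_)).resolve_right hsin
        rw [← Real.sin_pi, ← hM]
        push_cast
        ring_nf
      simp only [e1, e2, h0, zero_mul, zero_smul, add_zero, LinearEquiv.coe_one, id_eq]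
    · have e1 : (((2 * k + 1 : ℕ) : ℤ) - 2) / 2 = (k : ℤ) - 1 := by omega
      have e2 : (((2 * k + 1 : ℕ) : ℤ) - 1) / 2 = k := by omega
      have e3 : (((2 * k + 1 : ℕ) : ℤ) - 3) / 2 = (k : ℤ) - 1 := by omega
      have e4 : (((2 * k + 1 : ℕ) : ℤ)) / 2 = k := by omega
      have h0 : (S ℝ (k : ℤ)).eval (2 * Real.cos (2 * θ)) +
          (S ℝ ((k : ℤ) - 1)).eval (2 * Real.cos (2 * θ)) = 0 := by
        refine (mul_eq_zero.1 ?_).resolve_right hsin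
        rw [add_mul, hS, hS]
        have : ((k : ℤ) + 1 : ℝ) * (2 * θ) =
            2 * Real.pi - (((k : ℤ) - 1 : ℤ) + 1 : ℝ) * (2 * θ) := by
          rw [← hM]
          push_cast
          ring
        rw [this, Real.sin_two_pi_sub]
        ring
      simp only [e1, e2, e3, e4, h0, mul_zero, zero_smul, add_zero, LinearEquiv.coe_one, id_eq]

open Polynomial.Chebyshev in
theorem dvd_of_simpleReflection_mul_simpleReflection_pow_eq_one (M : CoxeterMatrix B) {i j : B}
    {k : ℕ} (h : (M.simpleReflection i * M.simpleReflection j) ^ k = 1) : M i j ∣ k := by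
  rcases eq_or_ne i j with rfl | hij
  · simp
  have h1 : M i j ≠ 1 := M.off_diagonal i j hij
  have hv := Module.reflection_mul_reflection_pow_apply_self (M.simpleCoroot_single_self i)
    (M.simpleCoroot_single_self j) k _ (M.simpleCoroot_mul_simpleCoroot i j)
  rw [simpleReflection, simpleReflection] at h
  rw [h] at hv
  have hx := DFunLike.congr_fun hv i
  have hy := DFunLike.congr_fun hv j
  simp only [LinearEquiv.coe_one, id_eq, Finsupp.add_apply, Finsupp.smul_apply,
    Finsupp.single_eq_same, Finsupp.single_eq_of_ne hij, Finsupp.single_eq_of_ne hij.symm,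
    smul_eq_mul, mul_one, mul_zero, add_zero, zero_add, simpleCoroot_single,
    M.symmetric j i] at hx hy
  rcases Nat.lt_or_ge (M i j) 3 with h3 | h3
  · obtain h | h : M i j = 0 ∨ M i j = 2 := by omega
    · simp [h] at hy ⊢
      exact hy
    · rw [h] at hx ⊢
      have : 2 * Real.cos (2 * (Real.pi / (2 : ℕ))) = -2 := by
        rw [Nat.cast_ofNat, mul_div_cancel₀ _ two_ne_zero, Real.cos_pi]; norm_num
      rw [this, S_eval_neg_two, S_eval_neg_two, Int.negOnePow_sub] at hx
      rcases Nat.even_or_odd k with hk | hk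
      · exact hk.two_dvd
      · rw [Int.negOnePow_odd k (by exact_mod_cast hk)] at hx
        simp at hx
        linarith
  · have hsin := sin_two_mul_pi_div_ne_zero h3
    have hS := S_two_mul_real_cos (2 * (Real.pi / M i j))
    have hcos : Real.cos (Real.pi / M i j) ≠ 0 := by
      intro hc
      rw [Real.sin_two_mul, hc, mul_zero] at hsin
      exact hsin rfl
    have h0 : (S ℝ ((k : ℤ) - 1)).eval (2 * Real.cos (2 * (Real.pi / M i j))) = 0 := by
      simpa [hcos] using hy.symm
    rw [h0, add_zero] at hx
    have s0 := hS (k - 1)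
    have s1 := hS k
    rw [h0, zero_mul] at s0
    rw [← hx, one_mul] at s1
    push_cast at s0 s1
    rw [sub_add_cancel] at s0
    rw [add_mul, one_mul, Real.sin_add, ← s0, zero_mul, zero_add] at s1
    have hc : Real.cos (k * (2 * (Real.pi / M i j))) = 1 :=
      (mul_right_cancel₀ hsin (s1.symm.trans (one_mul _).symm))
    obtain ⟨n, hn⟩ := (Real.cos_eq_one_iff _).1 hc
    have hM : (M i j : ℝ) ≠ 0 := by
      have : M i j ≠ 0 := by omega
      exact_mod_cast this
    have hkn : (n : ℝ) * M i j = k := by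
      have hpi := Real.pi_ne_zero
      field_simp at hn
      linarith
    exact Int.natCast_dvd_natCast.1 ⟨n, by rw [mul_comm]; exact_mod_cast hkn.symm⟩

end CoxeterMatrix

namespace CoxeterSystem

variable (cs : CoxeterSystem M W)

/-- The geometric representation of a Coxeter group. -/
noncomputable def geometricRep : W →* (B →₀ ℝ) ≃ₗ[ℝ] (B →₀ ℝ) :=
  cs.lift ⟨M.simpleReflection, M.simpleReflection_mul_simpleReflection_pow⟩

theorem geometricRep_simple (i : B) :
    cs.geometricRep (cs.simple i) = M.simpleReflection i :=
  cs.lift_apply_simple M.simpleReflection_mul_simpleReflection_pow i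

theorem dvd_of_simple_mul_simple_pow_eq_one {i j : B} {k : ℕ}
    (h : (cs.simple i * cs.simple j) ^ k = 1) : M i j ∣ k := by
  apply M.dvd_of_simpleReflection_mul_simpleReflection_pow_eq_one
  simpa [map_mul, geometricRep_simple] using congrArg cs.geometricRep h

theorem functionEnd_mul_apply {α : Type*} (f g : Function.End α) (a : α) :
    (f * g) a = f (g a) := rfl

theorem signedConj_mul_signedConj_pow_apply (i j : B) (n : ℕ) (t : W) (ε : ZMod 2) :
    ((cs.signedConj i * cs.signedConj j) ^ n) (t, ε) =
      ((cs.simple i * cs.simple j) ^ n * t * (cs.simple j * cs.simple i) ^ n,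
        ε + ∑ l ∈ Finset.range (2 * n),
          if t = (cs.simple j * cs.simple i) ^ l * cs.simple j then 1 else 0) := by
  induction n with
  | zero => simp; rfl
  | succ n ih =>
    have hinv : (cs.simple i * cs.simple j) ^ n = ((cs.simple j * cs.simple i) ^ n)⁻¹ := by
      rw [← inv_pow, mul_inv_rev, cs.inv_simple, cs.inv_simple]
    have hcomm : (cs.simple j * cs.simple i) ^ n * cs.simple j =
        cs.simple j * (cs.simple i * cs.simple j) ^ n := mul_pow_mul _ _ _
    rw [pow_succ', functionEnd_mul_apply, ih, functionEnd_mul_apply]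
    have h1 : (cs.simple i * cs.simple j) ^ n * t * (cs.simple j * cs.simple i) ^ n =
        cs.simple j ↔ t = (cs.simple j * cs.simple i) ^ (2 * n) * cs.simple j := by
      rw [two_mul, pow_add, mul_assoc _ _ (cs.simple j), hcomm, ← mul_assoc, hinv,
        ← eq_mul_inv_iff_mul_eq, inv_mul_eq_iff_eq_mul, mul_assoc]
    have h2 : cs.simple j * ((cs.simple i * cs.simple j) ^ n * t *
        (cs.simple j * cs.simple i) ^ n) * cs.simple j = cs.simple i ↔
        t = (cs.simple j * cs.simple i) ^ (2 * n + 1) * cs.simple j := by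
      rw [← eq_mul_inv_iff_mul_eq, ← eq_inv_mul_iff_mul_eq, ← eq_mul_inv_iff_mul_eq, hinv,
        inv_mul_eq_iff_eq_mul, ← hinv, cs.inv_simple, two_mul, add_right_comm, pow_add _ (n + 1),
        pow_succ, mul_assoc _ _ (cs.simple j), hcomm]
      simp only [mul_assoc]
    simp only [signedConj, h1, h2, Prod.mk.injEq, mul_add, mul_one, Finset.sum_range_succ]
    constructor
    · rw [pow_succ', pow_succ (cs.simple j * cs.simple i)]
      simp only [mul_assoc]
    · ring

/-- The parity of the number of occurrences of `t` in the right inversion sequence of a word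
for `w`. -/
noncomputable def rightInversionParity (w t : W) : ZMod 2 :=
  (cs.lift ⟨cs.signedConj, cs.isLiftable_signedConj⟩ w (t, 0)).2

theorem lift_signedConj_apply (w t : W) (ε : ZMod 2) :
    cs.lift ⟨cs.signedConj, cs.isLiftable_signedConj⟩ w (t, ε) =
      (w * t * w⁻¹, ε + cs.rightInversionParity w t) := by
  suffices ∀ t ε, cs.lift ⟨cs.signedConj, cs.isLiftable_signedConj⟩ w (t, ε) =
      (w * t * w⁻¹, ε + (cs.lift ⟨cs.signedConj, cs.isLiftable_signedConj⟩ w (t, 0)).2) from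
    this t ε
  induction w using cs.simple_induction_left with
  | one => intro t ε; simp [Function.End.one_def]
  | mul_simple_left w i ih =>
    intro t ε
    rw [map_mul, functionEnd_mul_apply, functionEnd_mul_apply, ih t ε, ih t 0, lift_apply_simple]
    simp only [signedConj, mul_inv_rev, cs.inv_simple, mul_assoc, zero_add, add_assoc]

theorem rightInversionParity_mul (v w t : W) :
    cs.rightInversionParity (v * w) t =
      cs.rightInversionParity w t + cs.rightInversionParity v (w * t * w⁻¹) := by
  rw [rightInversionParity, map_mul, functionEnd_mul_apply, lift_signedConj_apply,
    lift_signedConj_apply,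
    zero_add]

theorem rightInversionParity_simple (i : B) (t : W) :
    cs.rightInversionParity (cs.simple i) t = if t = cs.simple i then 1 else 0 := by
  simp [rightInversionParity, signedConj]

theorem rightInversionParity_one (t : W) : cs.rightInversionParity 1 t = 0 := by
  simp [rightInversionParity, Function.End.one_def]

theorem mem_rightInvSeq_of_rightInversionParity_ne_zero {ω : List B} {t : W}
    (h : cs.rightInversionParity (cs.wordProd ω) t ≠ 0) : t ∈ cs.rightInvSeq ω := by
  induction ω with
  | nil => simp [rightInversionParity_one] at h
  | cons i ω ih =>
    rw [wordProd_cons, rightInversionParity_mul, rightInversionParity_simple] at h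
    rw [rightInvSeq, List.mem_cons]
    by_cases ht : cs.rightInversionParity (cs.wordProd ω) t = 0
    · left
      by_contra hne
      rw [ht, zero_add, if_neg] at h
      · exact h rfl
      · intro he
        apply hne
        rw [← he]
        group
    · exact Or.inr (ih ht)

theorem length_mul_lt_of_rightInversionParity_ne_zero {w t : W}
    (h : cs.rightInversionParity w t ≠ 0) : cs.length (w * t) < cs.length w := by
  obtain ⟨ω, hω, rfl⟩ := cs.exists_isReduced w
  exact (cs.isRightInversion_of_mem_rightInvSeq hω
    (cs.mem_rightInvSeq_of_rightInversionParity_ne_zero h)).2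

theorem rightInversionParity_ne_zero_iff {w : W} {i : B} :
    cs.rightInversionParity w (cs.simple i) ≠ 0 ↔ cs.IsRightDescent w i := by
  refine ⟨cs.length_mul_lt_of_rightInversionParity_ne_zero, fun h h0 ↦ ?_⟩
  have := cs.length_mul_lt_of_rightInversionParity_ne_zero (w := w * cs.simple i)
    (t := cs.simple i) (by
      rw [rightInversionParity_mul, rightInversionParity_simple, cs.inv_simple,
        simple_mul_simple_cancel_right, h0, if_pos rfl, add_zero]
      exact one_ne_zero)
  rw [simple_mul_simple_cancel_right] at this
  exact lt_asymm this h

theorem exists_eq_of_rightInversionParity_alternatingWord_ne_zero {i j : B} {n : ℕ} {t : W}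
    (h : cs.rightInversionParity (cs.wordProd (alternatingWord i j n)) t ≠ 0) :
    ∃ k < n, t = (cs.simple j * cs.simple i) ^ k * cs.simple j := by
  induction n generalizing i j t with
  | zero => simp [alternatingWord, rightInversionParity_one] at h
  | succ n ih =>
    rw [alternatingWord_succ, wordProd_concat, rightInversionParity_mul,
      rightInversionParity_simple] at h
    by_cases ht : t = cs.simple j
    · exact ⟨0, n.succ_pos, by simpa using ht⟩
    · rw [if_neg ht, zero_add] at h
      obtain ⟨k, hk, he⟩ := ih h
      refine ⟨k + 1, Nat.succ_lt_succ hk, ?_⟩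
      rw [← eq_mul_inv_iff_mul_eq, inv_inv, ← eq_inv_mul_iff_mul_eq,
        cs.inv_simple] at he
      rw [he, mul_pow_mul, pow_succ']
      simp only [mul_assoc]

theorem isRightDescent_alternatingWord {i j : B} {n : ℕ} (hn : n ≠ 0)
    (hM : M i j = 0 ∨ n ≤ M i j) :
    cs.IsRightDescent (cs.wordProd (alternatingWord j i n)) i := by
  obtain ⟨n, rfl⟩ := Nat.exists_eq_succ_of_ne_zero hn
  rw [← rightInversionParity_ne_zero_iff, Nat.succ_eq_add_one, alternatingWord_succ,
    wordProd_concat, rightInversionParity_mul, rightInversionParity_simple, if_pos rfl,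
    cs.inv_simple, simple_mul_simple_cancel_right]
  suffices cs.rightInversionParity (cs.wordProd (alternatingWord i j n)) (cs.simple i) = 0 by
    rw [this, add_zero]
    exact one_ne_zero
  by_contra h
  obtain ⟨k, hk, he⟩ := cs.exists_eq_of_rightInversionParity_alternatingWord_ne_zero h
  have : (cs.simple j * cs.simple i) ^ (k + 1) = 1 := by
    rw [pow_succ, ← mul_assoc, ← he, simple_mul_simple_self]
  have hd := cs.dvd_of_simple_mul_simple_pow_eq_one this
  rw [M.symmetric j i] at hd
  rcases hM with hM | hM
  · rw [hM, zero_dvd_iff] at hd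
    omega
  · have := Nat.le_of_dvd k.succ_pos hd
    omega

theorem simple_mul_simple_mul_simple_of_eq_two {i j : B} (h : M i j = 2) :
    cs.simple j * cs.simple i * cs.simple j = cs.simple i := by
  have := cs.simple_mul_simple_pow' i j
  rw [h, pow_two, ← mul_assoc] at this
  rwa [mul_eq_one_iff_eq_inv, cs.inv_simple] at this

end CoxeterSystem

theorem mem_Hp_iff (cs : CoxeterSystem M W) (i : B) (g : W) :
    g ∈ Hp cs i ↔ cs.rightInversionParity g⁻¹ (cs.simple i) = 0 := by
  rw [← not_iff_not, ← ne_eq (cs.rightInversionParity _ _), cs.rightInversionParity_ne_zero_iff,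
    cs.isRightDescent_inv_iff]
  have := cs.length_simple_mul_ne g i
  simp only [Hp, Set.mem_ofPred_eq, CoxeterSystem.IsLeftDescent]
  omega

theorem mem_Hm_iff (cs : CoxeterSystem M W) (i : B) (g : W) :
    g ∈ Hm cs i ↔ cs.IsRightDescent g⁻¹ i := by
  rw [cs.isRightDescent_inv_iff]
  rfl

theorem disjoint_Hp_Hm (cs : CoxeterSystem M W) (i : B) : Disjoint (Hp cs i) (Hm cs i) :=
  Set.disjoint_left.2 fun _ hp hm ↦ lt_asymm (Set.mem_ofPred.1 hp) (Set.mem_ofPred.1 hm)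

theorem simple_smul_Hp_eq_iff (cs : CoxeterSystem M W) (i j : B) :
    cs.simple j • Hp cs i = Hp cs i ↔
      ∀ g, cs.rightInversionParity (g * cs.simple j) (cs.simple i) = 0 ↔
        cs.rightInversionParity g (cs.simple i) = 0 := by
  rw [Set.ext_iff]
  simp only [Set.mem_smul_set_iff_inv_smul_mem, smul_eq_mul, mem_Hp_iff, mul_inv_rev, inv_inv]
  exact (Equiv.inv W).forall_congr_left.trans (by simp)

/-- For `u ≠ s`: (a) `m_{su} = 2` iff `u` stabilizes `H_s^+`; (b) if `u · H_s^- ⊊ H_s^+`,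
then `m_{su} = ∞` (encoded as `M i j = 0`). -/
theorem commuting_iff_stabilizes (cs : CoxeterSystem M W) (i : B) :
    ∀ j : B, j ≠ i →
      ((M i j = 2 ↔ cs.simple j • Hp cs i = Hp cs i) ∧
       (cs.simple j • Hm cs i ⊂ Hp cs i → M i j = 0)) := by
  intro j hj
  have hM1 : M i j ≠ 1 := M.off_diagonal i j hj.symm
  have hne : cs.simple i ≠ cs.simple j := fun h ↦ hM1 <| Nat.dvd_one.1 <|
    cs.dvd_of_simple_mul_simple_pow_eq_one (by rw [h, pow_one, cs.simple_mul_simple_self])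
  refine ⟨?_, fun h ↦ ?_⟩
  · rw [simple_smul_Hp_eq_iff]
    simp only [cs.rightInversionParity_mul _ (cs.simple j), cs.rightInversionParity_simple,
      if_neg hne, zero_add, cs.inv_simple]
    refine ⟨fun h g ↦ by rw [cs.simple_mul_simple_mul_simple_of_eq_two h], fun h ↦ ?_⟩
    have hi := (h (cs.simple i)).not
    simp only [cs.rightInversionParity_simple, if_true] at hi
    have hc : cs.simple j * cs.simple i * cs.simple j = cs.simple i := by
      by_contra hc
      simp [hc] at hi
    have hd : M i j ∣ 2 := cs.dvd_of_simple_mul_simple_pow_eq_one (by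
      rw [pow_two, mul_assoc, ← mul_assoc (cs.simple j), hc, cs.simple_mul_simple_self])
    exact ((Nat.dvd_prime Nat.prime_two).1 hd).resolve_left hM1
  · by_contra h0
    obtain ⟨m, hm⟩ : ∃ m, M i j = m + 1 := Nat.exists_eq_succ_of_ne_zero h0
    have h1 : (cs.wordProd (CoxeterSystem.alternatingWord j i m))⁻¹ ∈ Hm cs i := by
      rw [mem_Hm_iff, inv_inv]
      exact cs.isRightDescent_alternatingWord (by omega) (Or.inr (by omega))
    have h2 : cs.simple j * (cs.wordProd (CoxeterSystem.alternatingWord j i m))⁻¹ ∈ Hm cs i := by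
      rw [mem_Hm_iff, mul_inv_rev, inv_inv, cs.inv_simple, ← cs.wordProd_concat,
        ← CoxeterSystem.alternatingWord_succ, ← hm]
      have := cs.wordProd_braidWord_eq i j
      rw [CoxeterSystem.braidWord, CoxeterSystem.braidWord, M.symmetric j i] at this
      rw [this]
      exact cs.isRightDescent_alternatingWord h0 (Or.inr le_rfl)
    exact Set.disjoint_left.1 (disjoint_Hp_Hm cs i) (h.1 ⟨_, h1, rfl⟩) h2
end
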